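/- For every n ≥ 5, the maximum number of colors in an edge-coloring of K_n with no properly colored 5-cycle equals n + 2. -/

import Mathlib

/-- Number of distinct colors used on the edges of `K_n` by the edge-coloring `c`. -/
def colorsUsed (n : ℕ) (c : Fin n → Fin n → ℕ) : ℕ :=
  ((Finset.univ.filter fun p : Fin n × Fin n => p.1 ≠ p.2).image fun p => c p.1 p.2).card

/-- The edge-colored `K_n` contains a properly colored cycle on `k` vertices. -/
def HasPCCycle (n k : ℕ) (c : Fin n → Fin n → ℕ) : Prop :=
  ∃ p : Fin k → Fin n, Function.Injective p ∧
    ∀ i : Fin k,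
      c (p i) (p ⟨(i.1 + 1) % k, Nat.mod_lt _ (Nat.lt_of_le_of_lt (Nat.zero_le _) i.isLt)⟩) ≠
        c (p ⟨(i.1 + 1) % k, Nat.mod_lt _ (Nat.lt_of_le_of_lt (Nat.zero_le _) i.isLt)⟩)
          (p ⟨(i.1 + 2) % k, Nat.mod_lt _ (Nat.lt_of_le_of_lt (Nat.zero_le _) i.isLt)⟩)

section PrivateColors

variable {V : Type*} {c : V → V → ℕ}

/-- The color of the edge `v a` occurs only on edges at `v`. -/
def PrivateAt (c : V → V → ℕ) (v a : V) : Prop :=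
  v ≠ a ∧ ∀ x y, x ≠ y → c x y = c v a → x = v ∨ y = v

/-- The edges `v a` and `v b` have distinct colors, both private at `v`. -/
def PrivatePair (c : V → V → ℕ) (v a b : V) : Prop :=
  PrivateAt c v a ∧ PrivateAt c v b ∧ c v a ≠ c v b

/-- No five distinct vertices span a properly colored 5-cycle. -/
def NoPCFiveCycle (c : V → V → ℕ) : Prop :=
  ∀ p q r s t : V, [p, q, r, s, t].Nodup → c p q ≠ c q r → c q r ≠ c r s →
    c r s ≠ c s t → c s t ≠ c t p → c t p ≠ c p q → False

theorem PrivatePair.symm {v a b : V} (h : PrivatePair c v a b) : PrivatePair c v b a :=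
  ⟨h.2.1, h.1, h.2.2.symm⟩

theorem PrivatePair.ne {v a b : V} (h : PrivatePair c v a b) : a ≠ b := by
  rintro rfl
  exact h.2.2 rfl

theorem PrivateAt.color_ne {u v w : V} (h : PrivateAt c u v) (hu : w ≠ u) (hv : w ≠ v) :
    c u v ≠ c v w := by
  intro e
  rcases h.2 v w hv.symm e.symm with h' | h'
  · exact h.1 h'.symm
  · exact hu h'

theorem PrivateAt.exists_pair (hD : ∀ v, ∃ a b, PrivatePair c v a b) {v y : V}
    (h : PrivateAt c v y) : ∃ b, PrivatePair c v y b := by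
  obtain ⟨a, b, hab⟩ := hD v
  by_cases e : c v y = c v a
  · exact ⟨b, h, hab.2.1, by rw [e]; exact hab.2.2⟩
  · exact ⟨a, h, hab.1, e⟩

theorem exists_privateAt_ne (hD : ∀ v, ∃ a b, PrivatePair c v a b) (v u : V) :
    ∃ a, PrivateAt c v a ∧ a ≠ u := by
  obtain ⟨a, b, h⟩ := hD v
  by_cases e : a = u
  · exact ⟨b, h.2.1, by rw [← e]; exact h.ne.symm⟩
  · exact ⟨a, h.1, e⟩

/-- If only `v` and `a` receive private edges of `w`, these edges are private at both ends. -/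
theorem PrivatePair.reverse (hs : ∀ i j, c i j = c j i) {w v a : V} (h : PrivatePair c w v a)
    (hN : ∀ x, PrivateAt c w x → x = v ∨ x = a) : PrivateAt c v w := by
  have key : ∀ y, w ≠ y → c w y = c w v → y = v := by
    intro y hy e
    rcases hN y ⟨hy, by rw [e]; exact h.1.2⟩ with h' | h'
    · exact h'
    · subst h'
      exact absurd e.symm h.2.2
  refine ⟨h.1.1.symm, fun x y hxy e => ?_⟩
  rw [hs v w] at e
  rcases h.1.2 x y hxy e with rfl | rfl
  · exact Or.inr (key y hxy e)
  · exact Or.inl (key x hxy.symm (by rw [hs]; exact e))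

/-- Private paths of length two leaving both ends of a private pair close up. -/
theorem PrivatePair.not_fork (hs : ∀ i j, c i j = c j i) (hC : NoPCFiveCycle c)
    {v a b a' b' : V} (h : PrivatePair c v a b) (ha : PrivateAt c a a') (hb : PrivateAt c b b')
    (hd : [v, a, b, a', b'].Nodup) : False := by
  simp only [List.nodup_cons, List.mem_cons, List.not_mem_nil, or_false, not_or] at hd
  have h1 := h.1.color_ne (w := a') (by tauto) (by tauto)
  have h2 := h.2.1.color_ne (w := b') (by tauto) (by tauto)
  have h3 := ha.color_ne (w := b') (by tauto) (by tauto)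
  have h4 := hb.color_ne (w := a') (by tauto) (by tauto)
  have h5 := h.2.2
  refine hC a' a v b b' ?_ ?_ ?_ ?_ ?_ ?_
  · simp only [List.nodup_cons, List.mem_cons, List.not_mem_nil, or_false, not_or]
    grind
  all_goals grind

/-- A private path of length three leaving `v`, prolonged by a private pair at `v`, closes up. -/
theorem PrivatePair.not_path (hs : ∀ i j, c i j = c j i) (hC : NoPCFiveCycle c)
    {v a b x y : V} (h : PrivatePair c v a b) (hb : PrivateAt c b x) (hx : PrivateAt c x y)
    (hd : [v, a, b, x, y].Nodup) : False := by
  simp only [List.nodup_cons, List.mem_cons, List.not_mem_nil, or_false, not_or] at hd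
  have h1 := h.1.color_ne (w := y) (by tauto) (by tauto)
  have h2 := h.2.1.color_ne (w := x) (by tauto) (by tauto)
  have h3 := hb.color_ne (w := y) (by tauto) (by tauto)
  have h4 := hx.color_ne (w := a) (by tauto) (by tauto)
  have h5 := h.2.2
  refine hC a v b x y ?_ ?_ ?_ ?_ ?_ ?_
  · simp only [List.nodup_cons, List.mem_cons, List.not_mem_nil, or_false, not_or]
    grind
  all_goals grind

/-- Two disjoint private pairs yield a properly colored 5-cycle. -/
theorem PrivatePair.not_disjoint (hs : ∀ i j, c i j = c j i) (hC : NoPCFiveCycle c)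
    {a a₁ a₂ b b₁ b₂ : V} (ha : PrivatePair c a a₁ a₂) (hb : PrivatePair c b b₁ b₂)
    (h0 : ∀ x ∈ [a, a₁, a₂], x ≠ b ∧ x ≠ b₁ ∧ x ≠ b₂) : False := by
  have main : ∀ z, PrivateAt c b z → c b z ≠ c b a₂ → (∀ x ∈ [a, a₁, a₂], x ≠ z) → False := by
    intro z hz hne hd
    simp only [List.mem_cons, List.not_mem_nil, or_false, forall_eq_or_imp, forall_eq] at hd h0
    have n1 := ha.1.1
    have n2 := ha.2.1.1
    have n3 := ha.ne
    have n4 := hz.1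
    have h1 := ha.1.color_ne (w := z) (by tauto) (by tauto)
    have h2 := ha.2.1.color_ne (w := b) (by tauto) (by tauto)
    have h3 := hz.color_ne (w := a₁) (by tauto) (by tauto)
    have h4 := ha.2.2
    refine hC a₁ a a₂ b z ?_ ?_ ?_ ?_ ?_ ?_
    · simp only [List.nodup_cons, List.mem_cons, List.not_mem_nil, or_false, not_or]
      grind
    all_goals grind
  by_cases e : c b b₁ = c b a₂
  · exact main b₂ hb.2.1 (by rw [← e]; exact hb.2.2.symm) fun x hx => (h0 x hx).2.2
  · exact main b₁ hb.1 e fun x hx => (h0 x hx).2.1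

theorem PrivatePair.not_shared_one (hs : ∀ i j, c i j = c j i) (hC : NoPCFiveCycle c)
    {u w x y z : V} (hu : PrivatePair c u x z) (hw : PrivatePair c w x y)
    (hd : [u, w, x, y, z].Nodup) : False := by
  simp only [List.nodup_cons, List.mem_cons, List.not_mem_nil, or_false, not_or] at hd
  have h1 := hu.1.color_ne (w := w) (by tauto) (by tauto)
  have h2 := hu.2.1.color_ne (w := y) (by tauto) (by tauto)
  have h3 := hw.2.1.color_ne (w := z) (by tauto) (by tauto)
  have h4 := hu.2.2
  have h5 := hw.2.2
  refine hC u x w y z ?_ ?_ ?_ ?_ ?_ ?_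
  · simp only [List.nodup_cons, List.mem_cons, List.not_mem_nil, or_false, not_or]
    grind
  all_goals grind

theorem PrivatePair.not_shared_both (hs : ∀ i j, c i j = c j i) (hC : NoPCFiveCycle c)
    {u w x y z : V} (hu : PrivatePair c u x y) (hw : PrivatePair c w x y) (hz : c z x ≠ c z y)
    (hd : [u, w, x, y, z].Nodup) : False := by
  simp only [List.nodup_cons, List.mem_cons, List.not_mem_nil, or_false, not_or] at hd
  have main : ∀ x y, PrivateAt c u y → PrivateAt c w x → [u, w, x, y, z].Nodup →
      c z x ≠ c z y → c u w ≠ c u y → c u w ≠ c w x → False := by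
    intro x y huy hwx hd hz h1 h2
    simp only [List.nodup_cons, List.mem_cons, List.not_mem_nil, or_false, not_or] at hd
    have h3 := huy.color_ne (w := z) (by tauto) (by tauto)
    have h4 := hwx.color_ne (w := z) (by tauto) (by tauto)
    refine hC u w x z y ?_ ?_ ?_ ?_ ?_ ?_
    · simp only [List.nodup_cons, List.mem_cons, List.not_mem_nil, or_false, not_or]
      grind
    all_goals grind
  have n1 := hu.1.color_ne (w := w) (by tauto) (by tauto)
  have key : ∀ a b, a ≠ u → a ≠ w → b ≠ u → b ≠ w → PrivateAt c u a → c u a ≠ c w b := by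
    intro a b h1 h2 h3 h4 h e
    rcases h.2 w b h4.symm e.symm with h' | h'
    · exact hd.1.1 h'.symm
    · exact h3 h'
  have k1 := key x x (by tauto) (by tauto) (by tauto) (by tauto) hu.1
  have k2 := key x y (by tauto) (by tauto) (by tauto) (by tauto) hu.1
  have k3 := key y x (by tauto) (by tauto) (by tauto) (by tauto) hu.2.1
  have k4 := key y y (by tauto) (by tauto) (by tauto) (by tauto) hu.2.1
  have e1 := hu.2.2
  have e2 := hw.2.2
  by_cases hc : c u w ≠ c u y ∧ c u w ≠ c w x
  · refine main x y hu.2.1 hw.1 ?_ hz hc.1 hc.2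
    simp only [List.nodup_cons, List.mem_cons, List.not_mem_nil, or_false, not_or]
    grind
  · refine main y x hu.1 hw.2.1 ?_ hz.symm ?_ ?_
    · simp only [List.nodup_cons, List.mem_cons, List.not_mem_nil, or_false, not_or]
      grind
    all_goals grind

/-- If each vertex of `R` has a private pair inside `R`, private pairs outside `R` end in `R`. -/
theorem PrivatePair.mem_of_notMem (hs : ∀ i j, c i j = c j i) (hC : NoPCFiveCycle c)
    (hD : ∀ v, ∃ a b, PrivatePair c v a b) {R : Finset V} (hne : R.Nonempty)
    (hR : ∀ x ∈ R, ∃ p ∈ R, ∃ q ∈ R, PrivatePair c x p q) {u x y : V} (hu : u ∉ R)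
    (h : PrivatePair c u x y) : x ∈ R ∧ y ∈ R := by
  have next : ∀ x ∈ R, ∀ z, ∃ p ∈ R, PrivateAt c x p ∧ p ≠ z := by
    intro x hx z
    obtain ⟨p, hp, q, hq, hpq⟩ := hR x hx
    by_cases e : p = z
    · exact ⟨q, hq, hpq.2.1, by rw [← e]; exact hpq.ne.symm⟩
    · exact ⟨p, hp, hpq.1, e⟩
  have mixed : ∀ x y, PrivatePair c u x y → x ∈ R → y ∉ R → False := by
    intro x y h hx hy
    by_cases hex : ∃ y', PrivateAt c y y' ∧ y' ≠ u ∧ y' ≠ x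
    · obtain ⟨y', hyy, hyu, hyx⟩ := hex
      obtain ⟨p, hp, hxp, hpy⟩ := next x hx y'
      refine h.not_fork hs hC hxp hyy ?_
      have := h.1.1
      have := h.2.1.1
      have := hxp.1
      have := hyy.1
      simp only [List.nodup_cons, List.mem_cons, List.not_mem_nil, or_false, not_or]
      grind
    · push Not at hex
      obtain ⟨p, q, hpq⟩ := hD y
      have hux : PrivatePair c y u x := by
        have := hpq.ne
        by_cases e : p = u
        · have hq : q = x := hex q hpq.2.1 (by rw [← e]; exact this.symm)
          rw [← e, ← hq]
          exact hpq
        · have hp := hex p hpq.1 e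
          have hq : q = u := by
            by_contra e'
            exact this (hp.trans (hex q hpq.2.1 e').symm)
          rw [← hp, ← hq]
          exact hpq.symm
      obtain ⟨r, hr, hxr, -⟩ := next x hx x
      obtain ⟨t, ht, hrt, htx⟩ := next r hr x
      refine hux.not_path hs hC hxr hrt ?_
      have := h.1.1
      have := h.2.1.1
      have := hxr.1
      have := hrt.1
      simp only [List.nodup_cons, List.mem_cons, List.not_mem_nil, or_false, not_or]
      grind
  by_cases hx : x ∈ R
  · exact ⟨hx, by_contra fun hy => mixed x y h hx hy⟩
  · by_cases hy : y ∈ R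
    · exact (mixed y x h.symm hy hx).elim
    · obtain ⟨a, ha⟩ := hne
      obtain ⟨p, hp, q, hq, hpq⟩ := hR a ha
      refine (hpq.not_disjoint hs hC h ?_).elim
      simp only [List.mem_cons, List.not_mem_nil, or_false, forall_eq_or_imp, forall_eq]
      grind

variable [Fintype V] in
/-- No triangle has private pairs at all of its vertices. -/
theorem PrivatePair.not_triangle (hs : ∀ i j, c i j = c j i) (hC : NoPCFiveCycle c)
    (hD : ∀ v, ∃ a b, PrivatePair c v a b) (hV : 5 ≤ Fintype.card V) {x y z : V}
    (hx : PrivatePair c x y z) (hy : PrivatePair c y x z) (hz : PrivatePair c z x y) : False := by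
  classical
  have hxy := hx.1.1
  have hxz := hx.2.1.1
  have hyz := hy.2.1.1
  set T : Finset V := {x, y, z} with hT
  have hcard : T.card ≤ 3 := Finset.card_le_three
  have hco : 1 < Tᶜ.card := by
    rw [Finset.card_compl]
    omega
  obtain ⟨u, hu, w, hw, huw⟩ := Finset.one_lt_card.1 hco
  rw [Finset.mem_compl] at hu hw
  have hR : ∀ a ∈ T, ∃ p ∈ T, ∃ q ∈ T, PrivatePair c a p q := by
    intro a ha
    simp only [hT, Finset.mem_insert, Finset.mem_singleton] at ha
    rcases ha with rfl | rfl | rfl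
    · exact ⟨y, by simp [hT], z, by simp [hT], hx⟩
    · exact ⟨x, by simp [hT], z, by simp [hT], hy⟩
    · exact ⟨x, by simp [hT], y, by simp [hT], hz⟩
  have pair : ∀ u, u ∉ T →
      PrivatePair c u x y ∨ PrivatePair c u x z ∨ PrivatePair c u y z := by
    intro u hu
    obtain ⟨p, q, h⟩ := hD u
    have hm := h.mem_of_notMem hs hC hD ⟨x, by simp [hT]⟩ hR hu
    have hne := h.ne
    have hsym := h.symm
    simp only [hT, Finset.mem_insert, Finset.mem_singleton] at hm
    rcases hm with ⟨rfl | rfl | rfl, rfl | rfl | rfl⟩ <;> tauto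
  have d : ∀ a b d : V, [a, b, d].Perm [x, y, z] → [u, w, a, b, d].Nodup := by
    intro a b d hp
    refine ((hp.cons w).cons u).nodup_iff.2 ?_
    simp only [hT, Finset.mem_insert, Finset.mem_singleton] at hu hw
    simp only [List.nodup_cons, List.mem_cons, List.not_mem_nil, or_false, not_or]
    grind
  have d1 := d x y z (List.Perm.refl _)
  have d2 := d x z y (by grind)
  have d3 := d y x z (by grind)
  have d4 := d y z x (by grind)
  have d5 := d z x y (by grind)
  have d6 := d z y x (by grind)
  rcases pair u hu with h | h | h <;> rcases pair w hw with k | k | k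
  · exact h.not_shared_both hs hC k hz.2.2 d1
  · exact h.not_shared_one hs hC k d2
  · exact h.symm.not_shared_one hs hC k d4
  · exact h.not_shared_one hs hC k d1
  · exact h.not_shared_both hs hC k hy.2.2 d2
  · exact h.symm.not_shared_one hs hC k.symm d6
  · exact h.not_shared_one hs hC k.symm d3
  · exact h.symm.not_shared_one hs hC k.symm d5
  · exact h.not_shared_both hs hC k hx.2.2 d4

/-- Consequence of `PrivatePair.not_fork` for the private neighborhoods of the two ends. -/
theorem PrivatePair.ends_cases (hs : ∀ i j, c i j = c j i) (hC : NoPCFiveCycle c)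
    {v a b : V} (h : PrivatePair c v a b) :
    (∀ x, PrivateAt c a x → x = v ∨ x = b) ∨ (∀ x, PrivateAt c b x → x = v ∨ x = a) ∨
    ∃ w, w ≠ v ∧ w ≠ a ∧ w ≠ b ∧ PrivateAt c a w ∧ PrivateAt c b w ∧
      (∀ x, PrivateAt c a x → x = v ∨ x = b ∨ x = w) ∧
      (∀ x, PrivateAt c b x → x = v ∨ x = a ∨ x = w) := by
  by_cases h1 : ∀ x, PrivateAt c a x → x = v ∨ x = b
  · exact Or.inl h1
  by_cases h2 : ∀ x, PrivateAt c b x → x = v ∨ x = a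
  · exact Or.inr (Or.inl h2)
  push Not at h1 h2
  obtain ⟨p, hp, hpv, hpb⟩ := h1
  obtain ⟨q, hq, hqv, hqa⟩ := h2
  have key : ∀ x y, PrivateAt c a x → PrivateAt c b y → x ≠ v → x ≠ b → y ≠ v → y ≠ a →
      x = y := by
    intro x y hx hy _ _ _ _
    by_contra hxy
    refine h.not_fork hs hC hx hy ?_
    have := h.1.1
    have := h.2.1.1
    have := h.ne
    have := hx.1
    have := hy.1
    simp only [List.nodup_cons, List.mem_cons, List.not_mem_nil, or_false, not_or]
    grind
  obtain rfl := key p q hp hq hpv hpb hqv hqa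
  refine Or.inr (Or.inr ⟨p, hpv, hqa, hpb, hp, hq, fun x hx => ?_, fun x hx => ?_⟩)
  · by_contra hx'
    push Not at hx'
    exact hx'.2.2 (key x p hx hq hx'.1 hx'.2.1 hqv hqa)
  · by_contra hx'
    push Not at hx'
    exact hx'.2.2 (key p x hp hx hpv hpb hx'.1 hx'.2.1).symm

theorem PrivatePair.eq_of_subset {v a b p q : V} (h : PrivatePair c v p q)
    (hN : ∀ x, PrivateAt c v x → x = a ∨ x = b) : PrivatePair c v a b := by
  have hne := h.ne
  have hsym := h.symm
  rcases hN p h.1 with rfl | rfl <;> rcases hN q h.2.1 with rfl | rfl <;> tauto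

/-- In the third alternative of `PrivatePair.ends_cases`, the common neighbor leads back. -/
theorem PrivatePair.common_subset (hs : ∀ i j, c i j = c j i) (hC : NoPCFiveCycle c)
    {v a b w : V} (h : PrivatePair c v a b) (hw : w ≠ v ∧ w ≠ a ∧ w ≠ b)
    (haw : PrivateAt c a w) (x : V) (hx : PrivateAt c w x) : x = v ∨ x = a ∨ x = b := by
  by_contra hx'
  push Not at hx'
  refine h.symm.not_path hs hC haw hx ?_
  have := h.1.1
  have := h.2.1.1
  have := h.ne
  have := hx.1
  simp only [List.nodup_cons, List.mem_cons, List.not_mem_nil, or_false, not_or]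
  grind

variable [Fintype V]

/-- A proper nonempty set of vertices is not closed under private edges. -/
theorem not_closed (hs : ∀ i j, c i j = c j i) (hC : NoPCFiveCycle c)
    (hD : ∀ v, ∃ a b, PrivatePair c v a b) (hV : 5 ≤ Fintype.card V) {R : Finset V}
    (hne : R.Nonempty) (hR : ∀ x ∈ R, ∀ y, PrivateAt c x y → y ∈ R) {u : V} (hu : u ∉ R) :
    False := by
  have hR' : ∀ x ∈ R, ∃ p ∈ R, ∃ q ∈ R, PrivatePair c x p q := by
    intro x hx
    obtain ⟨p, q, h⟩ := hD x
    exact ⟨p, hR x hx p h.1, q, hR x hx q h.2.1, h⟩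
  obtain ⟨x, y, h⟩ := hD u
  obtain ⟨hx, hy⟩ := h.mem_of_notMem hs hC hD hne hR' hu
  have hxu : ∀ x ∈ R, ∀ t, PrivateAt c x t → t ≠ u := by
    rintro x hx t ht rfl
    exact hu (hR x hx t ht)
  rcases h.ends_cases hs hC with h1 | h1 | ⟨z, hzu, hzx, hzy, hxz, hyz, h1, h2⟩
  · obtain ⟨t, ht, hty⟩ := exists_privateAt_ne hD x y
    exact (h1 t ht).elim (hxu x hx t ht) hty
  · obtain ⟨t, ht, hty⟩ := exists_privateAt_ne hD y x
    exact (h1 t ht).elim (hxu y hy t ht) hty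
  · have hz := hR x hx z hxz
    have h3 := h.common_subset hs hC ⟨hzu, hzx, hzy⟩ hxz
    obtain ⟨p, q, hp⟩ := hD x
    obtain ⟨p', q', hp'⟩ := hD y
    obtain ⟨p'', q'', hp''⟩ := hD z
    exact PrivatePair.not_triangle hs hC hD hV
      (hp.eq_of_subset fun t ht => (h1 t ht).resolve_left (hxu x hx t ht))
      (hp'.eq_of_subset fun t ht => (h2 t ht).resolve_left (hxu y hy t ht))
      (hp''.eq_of_subset fun t ht => (h3 t ht).resolve_left (hxu z hz t ht))

theorem not_closed_four (hs : ∀ i j, c i j = c j i) (hC : NoPCFiveCycle c)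
    (hD : ∀ v, ∃ a b, PrivatePair c v a b) (hV : 5 ≤ Fintype.card V) {p q r s : V}
    (hp : ∀ x, PrivateAt c p x → x = p ∨ x = q ∨ x = r ∨ x = s)
    (hq : ∀ x, PrivateAt c q x → x = p ∨ x = q ∨ x = r ∨ x = s)
    (hr : ∀ x, PrivateAt c r x → x = p ∨ x = q ∨ x = r ∨ x = s)
    (ht : ∀ x, PrivateAt c s x → x = p ∨ x = q ∨ x = r ∨ x = s) : False := by
  classical
  have hcard : ({p, q, r, s} : Finset V).card < Fintype.card V :=
    lt_of_le_of_lt Finset.card_le_four (by omega)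
  obtain ⟨u, hu⟩ : ∃ u, u ∉ ({p, q, r, s} : Finset V) := by
    by_contra hall
    push Not at hall
    rw [Finset.eq_univ_iff_forall.2 hall, Finset.card_univ] at hcard
    exact lt_irrefl _ hcard
  refine not_closed hs hC hD hV (R := {p, q, r, s}) ⟨p, by simp⟩ ?_ hu
  intro x hx y hy
  simp only [Finset.mem_insert, Finset.mem_singleton] at hx ⊢
  rcases hx with rfl | rfl | rfl | rfl
  exacts [hp y hy, hq y hy, hr y hy, ht y hy]

/-- An end of a private pair has a private edge leaving the pair. -/
theorem PrivatePair.not_end_subset (hs : ∀ i j, c i j = c j i) (hC : NoPCFiveCycle c)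
    (hD : ∀ v, ∃ a b, PrivatePair c v a b) (hV : 5 ≤ Fintype.card V) {v a b : V}
    (h : PrivatePair c v a b) (hN : ∀ x, PrivateAt c a x → x = v ∨ x = b) : False := by
  obtain ⟨p, q, hpq⟩ := hD a
  have ha := hpq.eq_of_subset hN
  have hba := ha.symm.reverse hs fun x hx => (hN x hx).symm
  have tri : PrivateAt c b v → False := fun hbv =>
    PrivatePair.not_triangle hs hC hD hV h ha
      ⟨hbv, hba, by rw [hs b a]; exact (ha.2.1.color_ne h.1.1 h.2.1.1).symm⟩
  rcases ha.ends_cases hs hC with h1 | h1 | ⟨w, hwa, hwv, hwb, hvw, -, h1, h2⟩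
  · exact tri (h.symm.reverse hs fun x hx => (h1 x hx).symm)
  · obtain ⟨p', q', hb⟩ := hD b
    exact tri (hb.eq_of_subset h1).2.1
  · have h3 := ha.common_subset hs hC ⟨hwa, hwv, hwb⟩ hvw
    refine not_closed_four hs hC hD hV (p := v) (q := a) (r := b) (s := w) ?_ ?_ ?_ ?_
    all_goals grind

theorem not_forall_exists_privatePair [Nonempty V] (hs : ∀ i j, c i j = c j i)
    (hC : NoPCFiveCycle c) (hV : 5 ≤ Fintype.card V)
    (hD : ∀ v, ∃ a b, PrivatePair c v a b) : False := by
  obtain ⟨v⟩ := ‹Nonempty V›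
  obtain ⟨a, b, h⟩ := hD v
  rcases h.ends_cases hs hC with h1 | h1 | ⟨w, hwv, hwa, hwb, haw, hbw, h1, h2⟩
  · exact h.not_end_subset hs hC hD hV h1
  · exact h.symm.not_end_subset hs hC hD hV h1
  have h3 := h.common_subset hs hC ⟨hwv, hwa, hwb⟩ haw
  have back : ∀ t, t = a ∨ t = b ∨ t = w → ¬ PrivateAt c t v := by
    intro t ht htv
    obtain ⟨s, hts⟩ := htv.exists_pair hD
    have hne := hts.ne
    have hs1 := hts.2.1
    rcases hts.ends_cases hs hC with h4 | h4 | ⟨z, hzt, hzv, hzs, hvz, hsz, h4, h5⟩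
    · exact hts.not_end_subset hs hC hD hV h4
    · exact hts.symm.not_end_subset hs hC hD hV h4
    · have hsR : s = a ∨ s = b ∨ s = w := by grind
      have hzR : z = a ∨ z = b ∨ z = w := by grind
      refine not_closed_four hs hC hD hV (p := v) (q := a) (r := b) (s := w) ?_ ?_ ?_ ?_
      all_goals grind
  obtain ⟨p, q, hp⟩ := hD a
  obtain ⟨p', q', hp'⟩ := hD b
  obtain ⟨p'', q'', hp''⟩ := hD w
  refine PrivatePair.not_triangle hs hC hD hV (x := a) (y := b) (z := w)
    (hp.eq_of_subset ?_) (hp'.eq_of_subset ?_) (hp''.eq_of_subset ?_)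
  all_goals grind

end PrivateColors

section Counting

variable {V : Type*} {c : V → V → ℕ}

/-- The colors of the edges inside `S`. -/
def colorsInside (c : V → V → ℕ) (S : Finset V) : Finset ℕ :=
  S.offDiag.image fun p => c p.1 p.2

theorem mem_colorsInside {S : Finset V} {k : ℕ} :
    k ∈ colorsInside c S ↔ ∃ x ∈ S, ∃ y ∈ S, x ≠ y ∧ c x y = k := by
  simp only [colorsInside, Finset.mem_image, Finset.mem_offDiag, Prod.exists]
  grind

theorem card_colorsInside_le_six [DecidableEq V] (hs : ∀ i j, c i j = c j i) {S : Finset V}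
    (hS : S.card = 4) :
    (colorsInside c S).card ≤ 6 := by
  obtain ⟨p, T, hp, rfl, hT⟩ := Finset.card_eq_succ.1 hS
  obtain ⟨q, r, s, -, -, -, rfl⟩ := Finset.card_eq_three.1 hT
  have hsub : colorsInside c (insert p {q, r, s}) ⊆
      {c p q, c p r, c p s, c q r, c q s, c r s} := by
    intro k hk
    obtain ⟨x, hx, y, hy, hxy, rfl⟩ := mem_colorsInside.1 hk
    simp only [Finset.mem_insert, Finset.mem_singleton] at hx hy ⊢
    grind
  exact (Finset.card_le_card hsub).trans Finset.card_le_six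

/-- Two colors lost by deleting `v` give a private pair at `v`. -/
theorem exists_privatePair_of_one_lt [DecidableEq V]
    (hs : ∀ i j, c i j = c j i) {S : Finset V} (v : S)
    (h : 1 < (colorsInside c S \ colorsInside c (S.erase v)).card) :
    ∃ a b : S, PrivatePair (fun x y : S => c x y) v a b := by
  have key : ∀ k ∈ colorsInside c S \ colorsInside c (S.erase v),
      ∃ a : S, c v a = k ∧ PrivateAt (fun x y : S => c x y) v a := by
    intro k hk
    rw [Finset.mem_sdiff] at hk
    obtain ⟨hk, hk'⟩ := hk
    have hv : ∀ x y : S, x ≠ y → c x y = k → x = v ∨ y = v := by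
      intro x y hxy e
      by_contra hcon
      push Not at hcon
      refine hk' (mem_colorsInside.2 ⟨x, ?_, y, ?_, fun e' => hxy (Subtype.ext e'), e⟩)
      · exact Finset.mem_erase.2 ⟨fun e' => hcon.1 (Subtype.ext e'), x.2⟩
      · exact Finset.mem_erase.2 ⟨fun e' => hcon.2 (Subtype.ext e'), y.2⟩
    obtain ⟨x, hx, y, hy, hxy, e⟩ := mem_colorsInside.1 hk
    have hne : (⟨x, hx⟩ : S) ≠ ⟨y, hy⟩ := fun e' => hxy (congrArg Subtype.val e')
    rcases hv ⟨x, hx⟩ ⟨y, hy⟩ hne e with h' | h'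
    · subst h'
      exact ⟨⟨y, hy⟩, e, hne, fun s t hst e' => hv s t hst (e'.trans e)⟩
    · subst h'
      have e2 : c y x = k := (hs y x).trans e
      exact ⟨⟨x, hx⟩, e2, hne.symm, fun s t hst e' => hv s t hst (e'.trans e2)⟩
  obtain ⟨k, hk, l, hl, hkl⟩ := Finset.one_lt_card.1 h
  obtain ⟨a, rfl, ha⟩ := key k hk
  obtain ⟨b, rfl, hb⟩ := key l hl
  exact ⟨a, b, ha, hb, hkl⟩

theorem card_colorsInside_le [DecidableEq V] (hs : ∀ i j, c i j = c j i)
    (hC : NoPCFiveCycle c) (m : ℕ) :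
    ∀ S : Finset V, S.card = m + 4 → (colorsInside c S).card ≤ m + 6 := by
  induction m with
  | zero => exact fun S hS => by simpa using card_colorsInside_le_six hs (by simpa using hS)
  | succ m ih =>
    intro S hS
    by_cases hex : ∃ v ∈ S, (colorsInside c S \ colorsInside c (S.erase v)).card ≤ 1
    · obtain ⟨v, hv, hle⟩ := hex
      have h1 := ih (S.erase v) (by rw [Finset.card_erase_of_mem hv]; omega)
      have h2 := Finset.card_le_card_sdiff_add_card (s := colorsInside c S)
        (t := colorsInside c (S.erase v))
      omega
    · push Not at hex
      have : Nonempty S := (Finset.card_pos.1 (by omega : 0 < S.card)).to_subtype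
      refine (not_forall_exists_privatePair (c := fun x y : S => c x y) (fun i j => hs i j) ?_
        (by rw [Fintype.card_coe]; omega)
        fun v => exists_privatePair_of_one_lt hs v (hex v v.2)).elim
      intro p q r s t hd
      exact hC p q r s t (by simpa using hd.map Subtype.val_injective)

end Counting

theorem noPCFiveCycle_of_not_hasPCCycle {n : ℕ} {c : Fin n → Fin n → ℕ}
    (h : ¬ HasPCCycle n 5 c) : NoPCFiveCycle c := by
  intro p q r s t hd h1 h2 h3 h4 h5
  refine h ⟨![p, q, r, s, t], ?_, ?_⟩
  · rw [← List.nodup_ofFn]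
    simpa using hd
  · intro i
    fin_cases i
    exacts [h1, h2, h3, h4, h5]

/-- A rainbow `K₄` on the vertices below `4`; each later vertex has its own color towards the
smaller ones. -/
def extremalColoring (n : ℕ) (i j : Fin n) : ℕ :=
  if max i.1 j.1 ≤ 3 then min i.1 j.1 + (max i.1 j.1).choose 2 else max i.1 j.1 + 2

theorem extremalColoring_comm {n : ℕ} (i j : Fin n) :
    extremalColoring n i j = extremalColoring n j i := by
  simp only [extremalColoring, max_comm, min_comm]

theorem extremalColoring_of_lt {n : ℕ} {i j : Fin n} (hi : 4 ≤ i.1) (h : j < i) :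
    extremalColoring n i j = i.1 + 2 := by
  have : max i.1 j.1 = i.1 := max_eq_left (le_of_lt h)
  rw [extremalColoring, this, if_neg (by omega)]

theorem not_hasPCCycle_extremalColoring (n : ℕ) : ¬ HasPCCycle n 5 (extremalColoring n) := by
  rintro ⟨p, hp, h⟩
  obtain ⟨i, hi⟩ := Finite.exists_max p
  have hlt : ∀ j, j ≠ i → p j < p i := fun j hj => lt_of_le_of_ne (hi j) fun e => hj (hp e)
  have h4 : 4 ≤ (p i).1 := by
    have hinj : Function.Injective fun j => (p j).1 := fun a b e => hp (Fin.ext e)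
    have hsub : Finset.univ.image (fun j => (p j).1) ⊆ Finset.range ((p i).1 + 1) := by
      intro x hx
      obtain ⟨j, -, rfl⟩ := Finset.mem_image.1 hx
      exact Finset.mem_range.2 (Nat.lt_succ_of_le (hi j))
    have := Finset.card_le_card hsub
    rw [Finset.card_image_of_injective _ hinj, Finset.card_range, Finset.card_univ,
      Fintype.card_fin] at this
    omega
  have key : ∀ a b : Fin 5, a ≠ i → b ≠ i →
      extremalColoring n (p a) (p i) = extremalColoring n (p i) (p b) := by
    intro a b ha hb
    rw [extremalColoring_comm, extremalColoring_of_lt h4 (hlt a ha),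
      extremalColoring_of_lt h4 (hlt b hb)]
  fin_cases i
  exacts [h 4 (key 4 1 (by decide) (by decide)), h 0 (key 0 2 (by decide) (by decide)),
    h 1 (key 1 3 (by decide) (by decide)), h 2 (key 2 4 (by decide) (by decide)),
    h 3 (key 3 0 (by decide) (by decide))]

theorem colorsUsed_eq_card_colorsInside (n : ℕ) (c : Fin n → Fin n → ℕ) :
    colorsUsed n c = (colorsInside c Finset.univ).card := by
  unfold colorsUsed colorsInside
  congr 2
  ext p
  simp

theorem le_colorsUsed_extremalColoring {n : ℕ} (hn : 5 ≤ n) :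
    n + 2 ≤ colorsUsed n (extremalColoring n) := by
  rw [colorsUsed_eq_card_colorsInside]
  conv_lhs => rw [← Finset.card_range (n + 2)]
  refine Finset.card_le_card fun k hk => ?_
  rw [Finset.mem_range] at hk
  rw [mem_colorsInside]
  have edge : ∀ i j : ℕ, i < j → j < n →
      (if max i j ≤ 3 then min i j + (max i j).choose 2 else max i j + 2) = k →
      ∃ x ∈ Finset.univ, ∃ y ∈ Finset.univ, x ≠ y ∧ extremalColoring n x y = k :=
    fun i j hij hj e => ⟨⟨i, hij.trans hj⟩, Finset.mem_univ _, ⟨j, hj⟩, Finset.mem_univ _,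
      fun e' => hij.ne (congrArg Fin.val e'), e⟩
  by_cases h6 : k < 6
  · interval_cases k
    · exact edge 0 1 (by omega) (by omega) (by decide)
    · exact edge 0 2 (by omega) (by omega) (by decide)
    · exact edge 1 2 (by omega) (by omega) (by decide)
    · exact edge 0 3 (by omega) (by omega) (by decide)
    · exact edge 1 3 (by omega) (by omega) (by decide)
    · exact edge 2 3 (by omega) (by omega) (by decide)
  · refine edge 0 (k - 2) (by omega) (by omega) ?_
    rw [max_eq_right (Nat.zero_le _), if_neg (by omega)]
    omega

theorem colorsUsed_le {n : ℕ} (hn : 5 ≤ n) {c : Fin n → Fin n → ℕ} (hs : ∀ i j, c i j = c j i)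
    (h : ¬ HasPCCycle n 5 c) : colorsUsed n c ≤ n + 2 := by
  rw [colorsUsed_eq_card_colorsInside]
  have := card_colorsInside_le hs (noPCFiveCycle_of_not_hasPCCycle h) (n - 4) Finset.univ
    (by rw [Finset.card_univ, Fintype.card_fin]; omega)
  omega

/-- For every `n ≥ 5`, the maximum number of colors in an edge-coloring of `K_n`
with no properly colored `C_5` equals `n + 2`. -/
theorem pr_C5 (n : ℕ) (hn : 5 ≤ n) :
    IsGreatest {m : ℕ | ∃ c : Fin n → Fin n → ℕ, (∀ i j, c i j = c j i) ∧
      ¬ HasPCCycle n 5 c ∧ colorsUsed n c = m} (n + 2) := by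
  have hE := not_hasPCCycle_extremalColoring n
  refine ⟨⟨extremalColoring n, extremalColoring_comm, hE, le_antisymm
    (colorsUsed_le hn extremalColoring_comm hE) (le_colorsUsed_extremalColoring hn)⟩, ?_⟩
  rintro m ⟨c, hs, h, rfl⟩
  exact colorsUsed_le hn hs h
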